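/- arXiv:1701.03892 — 4 statements merged into one kernel-verified Lean document; each statement's English description precedes it below -/
import Mathlib

section
/- Lévy–Wiener theorem (Lemma 2.1): Let c : ℤ → ℂ satisfy Σ_{k∈ℤ} |c_k| < ∞ and define F(θ) = Σ_{k∈ℤ} c_k e^{ikθ} for θ ∈ ℝ. Let U ⊆ ℂ be an open set containing the range of F, and let H : ℂ → ℂ be holomorphic on U. Then there exists d : ℤ → ℂ with Σ_{k∈ℤ} |d_k| < ∞ such that H(F(θ)) = Σ_{k∈ℤ} d_k e^{ikθ} for all θ ∈ ℝ. -/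
open Set Filter Topology MeasureTheory in
/-- `f` is an absolutely convergent Fourier series with coefficient norm at most `N`. -/
def WienerBd (f : ℝ → ℂ) (N : ℝ) : Prop :=
  ∃ d : ℤ → ℂ, Summable (fun k => ‖d k‖) ∧ ∑' k, ‖d k‖ ≤ N ∧
    ∀ θ : ℝ, HasSum (fun k : ℤ => d k * Complex.exp (Complex.I * (k : ℂ) * (θ : ℂ))) (f θ)

theorem norm_exp_char (k : ℤ) (θ : ℝ) :
    ‖Complex.exp (Complex.I * (k : ℂ) * (θ : ℂ))‖ = 1 := by
  rw [Complex.norm_exp]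
  simp

theorem summable_char {d : ℤ → ℂ} (hd : Summable (fun k => ‖d k‖)) (θ : ℝ) :
    Summable (fun k : ℤ => d k * Complex.exp (Complex.I * (k : ℂ) * (θ : ℂ))) := by
  refine Summable.of_norm ?_
  simpa [norm_mul, norm_exp_char] using hd

theorem WienerBd.tsum {ι : Type} {f : ι → ℝ → ℂ} {N : ι → ℝ} {F : ℝ → ℂ}
    (h : ∀ i, WienerBd (f i) (N i)) (hN : Summable N)
    (hF : ∀ θ, HasSum (fun i => f i θ) (F θ)) : WienerBd F (∑' i, N i) := by
  choose d hd hdN hsum using h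
  have hp : Summable (fun p : ι × ℤ => ‖d p.1 p.2‖) := by
    rw [summable_prod_of_nonneg (fun _ => norm_nonneg _)]
    refine ⟨hd, Summable.of_nonneg_of_le (fun i => tsum_nonneg fun _ => norm_nonneg _) hdN hN⟩
  have hp' : Summable (fun p : ℤ × ι => ‖d p.2 p.1‖) := hp.prod_symm
  have hcol : ∀ k, Summable (fun i => ‖d i k‖) := fun k => hp'.prod_factor k
  have hle : ∀ k, ‖∑' i, d i k‖ ≤ ∑' i, ‖d i k‖ := fun k => norm_tsum_le_tsum_norm (hcol k)
  have hs : Summable (fun k => ‖∑' i, d i k‖) :=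
    Summable.of_nonneg_of_le (fun _ => norm_nonneg _) hle hp'.prod
  refine ⟨fun k => ∑' i, d i k, hs, ?_, fun θ => ?_⟩
  · calc ∑' k, ‖∑' i, d i k‖ ≤ ∑' k, ∑' i, ‖d i k‖ := hs.tsum_le_tsum hle hp'.prod
      _ = ∑' i, ∑' k, ‖d i k‖ := Summable.tsum_comm (f := fun i k => ‖d i k‖) hp
      _ ≤ ∑' i, N i := Summable.tsum_le_tsum hdN hp.prod hN
  · have hq : Summable (fun p : ι × ℤ =>
        d p.1 p.2 * Complex.exp (Complex.I * (p.2 : ℂ) * (θ : ℂ))) := by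
      refine Summable.of_norm ?_
      simpa [norm_mul, norm_exp_char] using hp
    have h1 : ∑' k : ℤ, (∑' i, d i k) * Complex.exp (Complex.I * (k : ℂ) * (θ : ℂ)) = F θ := by
      rw [← (hF θ).tsum_eq]
      simp_rw [← tsum_mul_right]
      rw [Summable.tsum_comm (f := fun i (k : ℤ) =>
        d i k * Complex.exp (Complex.I * (k : ℂ) * (θ : ℂ))) hq]
      exact tsum_congr fun i => (hsum i θ).tsum_eq
    rw [← h1]
    exact (summable_char hs θ).hasSum

theorem WienerBd.shift {f : ℝ → ℂ} {N : ℝ} (h : WienerBd f N) (a : ℂ) (m : ℤ) :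
    WienerBd (fun θ => a * Complex.exp (Complex.I * (m : ℂ) * (θ : ℂ)) * f θ) (‖a‖ * N) := by
  obtain ⟨d, hd, hN, hs⟩ := h
  have hd' : Summable (fun k => ‖d (k - m)‖) := (Equiv.subRight m).summable_iff.mpr hd
  have ht : ∑' k, ‖d (k - m)‖ = ∑' k, ‖d k‖ := (Equiv.subRight m).tsum_eq (fun k => ‖d k‖)
  refine ⟨fun k => a * d (k - m), ?_, ?_, fun θ => ?_⟩
  · simpa [norm_mul] using hd'.mul_left ‖a‖
  · simp only [norm_mul]
    rw [tsum_mul_left, ht]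
    gcongr
  · have h1 := ((Equiv.subRight m).hasSum_iff.mpr (hs θ)).mul_left
      (a * Complex.exp (Complex.I * (m : ℂ) * (θ : ℂ)))
    refine h1.congr_fun fun k => ?_
    simp only [Function.comp, Equiv.subRight_apply]
    have : Complex.exp (Complex.I * (k : ℂ) * (θ : ℂ)) =
        Complex.exp (Complex.I * (m : ℂ) * (θ : ℂ)) *
        Complex.exp (Complex.I * ((k - m : ℤ) : ℂ) * (θ : ℂ)) := by
      rw [← Complex.exp_add]
      congr 1
      push_cast
      ring
    rw [this]
    ring

theorem WienerBd.mono {f : ℝ → ℂ} {N N' : ℝ} (h : WienerBd f N) (hN : N ≤ N') :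
    WienerBd f N' := by
  obtain ⟨d, hd, h1, hs⟩ := h
  exact ⟨d, hd, h1.trans hN, hs⟩

theorem WienerBd.nonneg {f : ℝ → ℂ} {N : ℝ} (h : WienerBd f N) : 0 ≤ N := by
  obtain ⟨d, hd, h1, hs⟩ := h
  exact (tsum_nonneg fun _ => norm_nonneg _).trans h1

theorem WienerBd.norm_le {f : ℝ → ℂ} {N : ℝ} (h : WienerBd f N) (θ : ℝ) : ‖f θ‖ ≤ N := by
  obtain ⟨d, hd, h1, hs⟩ := h
  rw [← (hs θ).tsum_eq]
  refine (norm_tsum_le_tsum_norm ?_).trans ?_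
  · simpa [norm_mul, norm_exp_char] using hd
  · simpa [norm_mul, norm_exp_char] using h1

theorem WienerBd.mul {f g : ℝ → ℂ} {N N' : ℝ} (hf : WienerBd f N) (hg : WienerBd g N') :
    WienerBd (fun θ => f θ * g θ) (N * N') := by
  have hg0 := hg.nonneg
  obtain ⟨d, hd, h1, hs⟩ := hf
  have := WienerBd.tsum (fun k => hg.shift (d k) k) (hd.mul_right N')
    (F := fun θ => f θ * g θ) (fun θ => (hs θ).mul_right (g θ))
  refine this.mono ?_
  rw [tsum_mul_right]
  gcongr

theorem WienerBd.one : WienerBd (fun _ => 1) 1 := by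
  refine ⟨Pi.single 0 1, ?_, ?_, fun θ => ?_⟩
  · refine (hasSum_single 0 ?_).summable
    intro b hb
    simp [hb]
  · rw [tsum_eq_single 0]
    · simp
    · intro b hb
      simp [hb]
  · convert hasSum_single (0 : ℤ) ?_ using 1
    · simp
    · intro b hb
      simp [hb]

theorem WienerBd.pow {f : ℝ → ℂ} {N : ℝ} (h : WienerBd f N) (n : ℕ) :
    WienerBd (fun θ => f θ ^ n) (N ^ n) := by
  induction n with
  | zero => simpa using WienerBd.one
  | succ n ih => simpa [pow_succ] using ih.mul h

open Real MeasureTheory in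
theorem WienerBd.of_deriv {g g' : ℝ → ℂ} {A B : ℝ} (hg : ∀ x, HasDerivAt g (g' x) x)
    (hg' : Continuous g') (hper : Function.Periodic g (2 * π)) (hA : ∀ x, ‖g x‖ ≤ A)
    (hB : ∀ x, ‖g' x‖ ≤ B) (hB0 : 0 < B) :
    WienerBd g (A + B * ((1 + ∑' k : ℤ, 1 / (k : ℝ) ^ 2) / 2)) := by
  have hab : (0 : ℝ) < 2 * π := by positivity
  have : Fact (0 < 2 * π - 0) := ⟨by simpa using hab⟩
  have hcont : Continuous g := continuous_iff_continuousAt.mpr fun x => (hg x).continuousAt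
  have hper0 : Function.Periodic g (2 * π - 0) := by simpa using hper
  let G : C(AddCircle (2 * π - 0), ℂ) := ⟨hper0.lift, continuous_coinduced_dom.mpr hcont⟩
  have hG : ∀ x : ℝ, G (x : AddCircle (2 * π - 0)) = g x := fun x => rfl
  have hco : ∀ n, fourierCoeff G n = fourierCoeffOn hab g n := by
    intro n
    unfold fourierCoeffOn
    congr 1
    ext x
    obtain ⟨y, hy, rfl⟩ := AddCircle.coe_image_Ioc_eq (2 * π - 0) 0 ▸ Set.mem_univ x
    rw [AddCircle.liftIoc_coe_apply hy, hG]
  have hML : MemLp g' 2 (volume.restrict (Set.Ioc 0 (2 * π))) :=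
    MemLp.of_bound hg'.aestronglyMeasurable B (Filter.Eventually.of_forall hB)
  have hP := hasSum_sq_fourierCoeffOn hab hML
  have hPle : ((2 * π - 0)⁻¹ • ∫ x in (0)..(2 * π), ‖g' x‖ ^ 2) ≤ B ^ 2 := by
    have : ∫ x in (0)..(2 * π), ‖g' x‖ ^ 2 ≤ ∫ x in (0)..(2 * π), B ^ 2 := by
      apply intervalIntegral.integral_mono_on hab.le
      · exact (by fun_prop : Continuous fun x => ‖g' x‖ ^ 2).intervalIntegrable _ _
      · exact continuous_const.intervalIntegrable _ _
      · intro x _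
        have := hB x
        gcongr
    rw [intervalIntegral.integral_const] at this
    simp only [sub_zero, smul_eq_mul] at this ⊢
    rw [inv_mul_le_iff₀ hab]
    exact this
  have h0 : ‖fourierCoeffOn hab g 0‖ ≤ A := by
    rw [fourierCoeffOn_eq_integral]
    have : ‖∫ x in (0)..(2 * π), fourier (-0) (x : AddCircle (2 * π - 0)) • g x‖
        ≤ A * |2 * π - 0| := by
      apply intervalIntegral.norm_integral_le_of_norm_le_const
      intro x _
      simpa using hA x
    rw [norm_smul]
    rw [sub_zero, abs_of_pos hab] at this
    rw [sub_zero, Real.norm_of_nonneg (by positivity), one_div, inv_mul_le_iff₀ hab,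
      mul_comm _ A]
    exact this
  have hk : ∀ k : ℤ, k ≠ 0 → ‖fourierCoeffOn hab g k‖ = ‖fourierCoeffOn hab g' k‖ / |(k : ℝ)| := by
    intro k hk
    rw [fourierCoeffOn_of_hasDerivAt hab hk (fun x _ => hg x) (hg'.intervalIntegrable _ _)]
    have e : g (2 * π) - g 0 = 0 := by
      have := hper 0
      rw [zero_add] at this
      rw [this, sub_self]
    rw [e]
    simp only [mul_zero, zero_sub, norm_mul, norm_neg, norm_div, norm_one, sub_zero,
      Complex.norm_I, Complex.ofReal_zero, Complex.norm_real, Complex.norm_intCast,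
      Complex.norm_ofNat, Complex.ofReal_mul, Complex.ofReal_ofNat, mul_one]
    have : (0 : ℝ) < |(k : ℝ)| := by
      rw [abs_pos]
      exact_mod_cast hk
    have h2 : ‖π‖ ≠ 0 := by
      rw [norm_ne_zero_iff]
      exact pi_ne_zero
    field_simp
  have hsq : Summable (fun k : ℤ => 1 / (k : ℝ) ^ 2) :=
    Real.summable_one_div_int_pow.mpr (by norm_num)
  have hmaj : ∀ k : ℤ, ‖fourierCoeffOn hab g k‖ ≤ (if k = 0 then A else 0) +
      (‖fourierCoeffOn hab g' k‖ ^ 2 * (1 / B) + B * (1 / (k : ℝ) ^ 2)) * (1 / 2) := by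
    intro k
    by_cases hk0 : k = 0
    · subst hk0
      simp only [if_true]
      have : 0 ≤ (‖fourierCoeffOn hab g' 0‖ ^ 2 * (1 / B) +
        B * (1 / ((0 : ℤ) : ℝ) ^ 2)) * (1 / 2) := by positivity
      linarith
    · rw [hk k hk0, if_neg hk0, zero_add]
      have hpos : (0 : ℝ) < |(k : ℝ)| := by
        rw [abs_pos]
        exact_mod_cast hk0
      rw [← sq_abs (k : ℝ)]
      set t := |(k : ℝ)|
      set u := ‖fourierCoeffOn hab g' k‖
      have : (u ^ 2 * (1 / B) + B * (1 / t ^ 2)) * (1 / 2) - u / t =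
          (u - B / t) ^ 2 / (2 * B) := by
        field_simp
        ring
      have h3 : 0 ≤ (u - B / t) ^ 2 / (2 * B) := by positivity
      linarith
  have hmajS : HasSum (fun k : ℤ => (if k = 0 then A else 0) +
      (‖fourierCoeffOn hab g' k‖ ^ 2 * (1 / B) + B * (1 / (k : ℝ) ^ 2)) * (1 / 2))
      (A + (((2 * π - 0)⁻¹ • ∫ x in (0)..(2 * π), ‖g' x‖ ^ 2) * (1 / B) +
        B * ∑' k : ℤ, 1 / (k : ℝ) ^ 2) * (1 / 2)) :=
    (hasSum_ite_eq 0 A).add (((hP.mul_right _).add (hsq.hasSum.mul_left _)).mul_right _)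
  have hS : Summable (fun k => ‖fourierCoeffOn hab g k‖) :=
    Summable.of_nonneg_of_le (fun _ => norm_nonneg _) hmaj hmajS.summable
  refine ⟨fun k => fourierCoeffOn hab g k, hS, ?_, fun θ => ?_⟩
  · refine (hS.tsum_le_tsum hmaj hmajS.summable).trans ?_
    rw [hmajS.tsum_eq]
    have : ((2 * π - 0)⁻¹ • ∫ x in (0)..(2 * π), ‖g' x‖ ^ 2) * (1 / B) ≤ B := by
      rw [mul_one_div, div_le_iff₀ hB0]
      nlinarith
    linarith
  · have hs : Summable (fourierCoeff G) := by
      refine Summable.of_norm ?_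
      simpa only [hco] using hS
    have := has_pointwise_sum_fourier_series_of_summable hs (θ : AddCircle (2 * π - 0))
    rw [hG] at this
    convert this using 2 with k
    rw [hco, smul_eq_mul, fourier_coe_apply]
    congr 2
    push_cast
    have : (π : ℂ) ≠ 0 := by exact_mod_cast pi_ne_zero
    field_simp
    simp
    ring

theorem exp_char_periodic (k : ℤ) (θ : ℝ) :
    Complex.exp (Complex.I * (k : ℂ) * ((θ + 2 * Real.pi : ℝ) : ℂ)) =
      Complex.exp (Complex.I * (k : ℂ) * (θ : ℂ)) := by
  rw [Complex.exp_eq_exp_iff_exists_int]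
  refine ⟨k, ?_⟩
  push_cast
  ring

open Metric in
theorem levy_wiener_bd {H : ℂ → ℂ} {U : Set ℂ} (hU : IsOpen U) (hH : DifferentiableOn ℂ H U)
    {P P' E : ℝ → ℂ} {ρ M D : ℝ} (hρ : 0 < ρ) (hM : 0 < M) (hD : 0 < D)
    (hball : ∀ θ, closedBall (P θ) ρ ⊆ U)
    (hbd : ∀ θ, ∀ z ∈ closedBall (P θ) ρ, ‖H z‖ ≤ M)
    (hP : ∀ x, HasDerivAt P (P' x) x) (hP' : Continuous P')
    (hper : Function.Periodic P (2 * Real.pi)) (hPD : ∀ x, ‖P' x‖ ≤ D)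
    (hE : WienerBd E (ρ / 2)) :
    ∃ N, WienerBd (fun θ => H (P θ + E θ)) N := by
  have hPU : ∀ θ, P θ ∈ U := fun θ => hball θ (mem_closedBall_self hρ.le)
  have hAn : ∀ n, AnalyticOnNhd ℂ (iteratedDeriv n H) U := by
    intro n
    rw [iteratedDeriv_eq_iterate]
    exact (hH.analyticOnNhd hU).iterated_deriv n
  have hcontP : Continuous P := continuous_iff_continuousAt.mpr fun x => (hP x).continuousAt
  have hest : ∀ n θ, ‖iteratedDeriv n H (P θ)‖ ≤ n.factorial * M / ρ ^ n := by
    intro n θ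
    apply Complex.norm_iteratedDeriv_le_of_forall_mem_sphere_norm_le n hρ
    · refine (hH.mono ?_).diffContOnCl
      rw [closure_ball _ hρ.ne']
      exact hball θ
    · intro z hz
      exact hbd θ z (sphere_subset_closedBall hz)
  set C := (1 + ∑' k : ℤ, 1 / (k : ℝ) ^ 2) / 2 with hC
  have hg : ∀ n : ℕ, WienerBd (fun θ => (n.factorial : ℂ)⁻¹ * iteratedDeriv n H (P θ))
      (M / ρ ^ n + ((n + 1) * M / ρ ^ (n + 1) * D) * C) := by
    intro n
    have hf : (0 : ℝ) < n.factorial := by exact_mod_cast n.factorial_pos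
    refine WienerBd.of_deriv
      (g' := fun θ => (n.factorial : ℂ)⁻¹ * (iteratedDeriv (n + 1) H (P θ) * P' θ)) ?_ ?_ ?_ ?_ ?_ ?_
    · intro x
      have h1 : HasDerivAt (iteratedDeriv n H) (iteratedDeriv (n + 1) H (P x)) (P x) := by
        rw [iteratedDeriv_succ]
        exact (hAn n _ (hPU x)).differentiableAt.hasDerivAt
      exact (h1.comp x (hP x)).const_mul _
    · have : Continuous (fun θ => iteratedDeriv (n + 1) H (P θ)) :=
        (hAn (n + 1)).continuousOn.comp_continuous hcontP hPU
      fun_prop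
    · intro x
      simp only [hper x]
    · intro x
      have := hest n x
      rw [norm_mul, norm_inv, Complex.norm_natCast, inv_mul_le_iff₀ hf]
      rwa [← mul_div_assoc]
    · intro x
      have h1 := hest (n + 1) x
      rw [norm_mul, norm_inv, Complex.norm_natCast, inv_mul_le_iff₀ hf, norm_mul]
      calc _ ≤ ((n + 1).factorial * M / ρ ^ (n + 1)) * D := by
            gcongr
            exact hPD x
        _ = _ := by
            rw [Nat.factorial_succ]
            push_cast
            ring
    · positivity
  have hterm := fun n => (hg n).mul (hE.pow n)
  have hsum : Summable (fun n : ℕ =>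
      (M / ρ ^ n + ((n + 1) * M / ρ ^ (n + 1) * D) * C) * (ρ / 2) ^ n) := by
    have h1 : Summable (fun n : ℕ => (1 / 2 : ℝ) ^ n) := summable_geometric_two
    have h2 : Summable (fun n : ℕ => (n : ℝ) ^ 1 * (1 / 2 : ℝ) ^ n) :=
      summable_pow_mul_geometric_of_norm_lt_one 1 (by norm_num)
    have h3 := (h1.mul_left (M + M * D * C / ρ)).add (h2.mul_left (M * D * C / ρ))
    refine h3.congr fun n => ?_
    rw [div_pow, div_pow, pow_succ]
    field_simp
    ring
  refine ⟨_, WienerBd.tsum hterm hsum fun θ => ?_⟩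
  have hEn := hE.norm_le θ
  have hz : P θ + E θ ∈ ball (P θ) ρ := by
    rw [mem_ball, dist_eq_norm, add_sub_cancel_left]
    linarith
  have := Complex.hasSum_taylorSeries_on_ball
    (hH.mono (ball_subset_closedBall.trans (hball θ))) hz
  refine this.congr_fun fun n => ?_
  simp only [smul_eq_mul, add_sub_cancel_left]
  ring

/-- Lévy–Wiener theorem: if `F` is an absolutely convergent Fourier series
with coefficients `c : ℤ → ℂ`, and `H` is holomorphic on an open set `U`
containing the range of `F`, then `H ∘ F` is again an absolutely convergent
Fourier series. -/
theorem levy_wiener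
    (c : ℤ → ℂ) (hc : Summable (fun k => ‖c k‖))
    (F : ℝ → ℂ)
    (hF : ∀ θ : ℝ, F θ = ∑' k : ℤ, c k * Complex.exp (Complex.I * (k : ℂ) * (θ : ℂ)))
    (U : Set ℂ) (hU : IsOpen U) (hrange : ∀ θ : ℝ, F θ ∈ U)
    (H : ℂ → ℂ) (hH : DifferentiableOn ℂ H U) :
    ∃ d : ℤ → ℂ, Summable (fun k => ‖d k‖) ∧
      ∀ θ : ℝ, H (F θ) =
        ∑' k : ℤ, d k * Complex.exp (Complex.I * (k : ℂ) * (θ : ℂ)) := by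
  have hFc : Continuous F := by
    rw [funext hF]
    refine continuous_tsum (fun k => by fun_prop) hc fun k θ => ?_
    simp [norm_exp_char]
  have hFper : Function.Periodic F (2 * Real.pi) := by
    intro x
    rw [hF, hF]
    simp only [exp_char_periodic]
  set K := F '' Set.Icc 0 (2 * Real.pi) with hKdef
  have hK : IsCompact K := isCompact_Icc.image hFc
  have hFK : ∀ θ, F θ ∈ K := by
    intro θ
    obtain ⟨y, hy, e⟩ := hFper.exists_mem_Ico₀ (by positivity) θ
    exact ⟨y, Set.Ico_subset_Icc_self hy, e.symm⟩
  have hKU : K ⊆ U := by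
    rintro _ ⟨θ, _, rfl⟩
    exact hrange θ
  obtain ⟨δ, hδ, hδU⟩ := hK.exists_cthickening_subset_open hU hKU
  obtain ⟨M, hM⟩ := (hK.cthickening (r := δ)).exists_bound_of_continuousOn (hH.continuousOn.mono hδU)
  have hρ : 0 < δ / 2 := by positivity
  -- choose the trigonometric polynomial
  obtain ⟨S, hS⟩ : ∃ S : Finset ℤ, ∑' k : {x // x ∉ S}, ‖c k‖ < δ / 2 / 2 :=
    ((tendsto_tsum_compl_atTop_zero (fun k => ‖c k‖)).eventually
      (gt_mem_nhds (by positivity : 0 < δ / 2 / 2))).exists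
  set P : ℝ → ℂ := fun θ => ∑ k ∈ S, c k * Complex.exp (Complex.I * (k : ℂ) * (θ : ℂ)) with hPdef
  set P' : ℝ → ℂ := fun θ => ∑ k ∈ S, c k * (Complex.exp (Complex.I * (k : ℂ) * (θ : ℂ)) *
    (Complex.I * (k : ℂ))) with hP'def
  have hE : WienerBd (fun θ => F θ - P θ) (δ / 2 / 2) := by
    classical
    set d : ℤ → ℂ := fun k => if k ∈ S then 0 else c k with hd
    have hdS : Summable (fun k => ‖d k‖) := by
      refine Summable.of_nonneg_of_le (fun _ => norm_nonneg _) (fun k => ?_) hc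
      by_cases h : k ∈ S <;> simp [hd, h]
    refine ⟨d, hdS, ?_, fun θ => ?_⟩
    · refine le_trans (le_of_eq ?_) hS.le
      have h1 := tsum_subtype {x : ℤ | x ∉ S} (fun k => ‖c k‖)
      refine Eq.trans ?_ h1.symm
      refine tsum_congr fun k => ?_
      by_cases h : k ∈ S <;> simp [hd, h]
    · have h1 := (summable_char hc θ).hasSum
      rw [← hF] at h1
      have h2 : HasSum (fun k : ℤ => if k ∈ S then
          c k * Complex.exp (Complex.I * (k : ℂ) * (θ : ℂ)) else 0) (P θ) := by
        have h3 : P θ = ∑ k ∈ S, (if k ∈ S then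
          c k * Complex.exp (Complex.I * (k : ℂ) * (θ : ℂ)) else 0) :=
          Finset.sum_congr rfl fun k hk => by simp [hk]
        rw [h3]
        exact hasSum_sum_of_ne_finset_zero fun k hk => by simp [hk]
      refine (h1.sub h2).congr_fun ?_
      intro k
      by_cases h : k ∈ S <;> simp [hd, h]
  have hnear : ∀ θ, ∀ z ∈ Metric.closedBall (P θ) (δ / 2), z ∈ Metric.cthickening δ K := by
    intro θ z hz
    refine Metric.mem_cthickening_of_dist_le z (F θ) δ K (hFK θ) ?_
    have h1 := hE.norm_le θ
    rw [← dist_eq_norm, dist_comm] at h1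
    have h2 := dist_triangle z (P θ) (F θ)
    have h3 := Metric.mem_closedBall.mp hz
    linarith
  obtain ⟨N, d, hd, -, hs⟩ := levy_wiener_bd hU hH (P := P) (P' := P') (E := fun θ => F θ - P θ)
    (ρ := δ / 2) (M := max M 1) (D := 1 + ∑ k ∈ S, ‖c k‖ * |(k : ℝ)|)
    hρ (by positivity) (by positivity) (fun θ z hz => hδU (hnear θ z hz))
    (fun θ z hz => (hM z (hnear θ z hz)).trans (le_max_left _ _))
    (by
      intro x
      refine HasDerivAt.fun_sum fun k _ => ?_
      refine HasDerivAt.const_mul _ ?_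
      have h1 : HasDerivAt (fun y : ℝ => Complex.I * (k : ℂ) * (y : ℂ)) (Complex.I * (k : ℂ)) x := by
        simpa using (Complex.ofRealCLM.hasDerivAt (x := x)).const_mul (Complex.I * (k : ℂ))
      exact h1.cexp)
    (by fun_prop)
    (by
      intro x
      simp only [hPdef, exp_char_periodic])
    (by
      intro x
      have : ‖P' x‖ ≤ ∑ k ∈ S, ‖c k‖ * |(k : ℝ)| := by
        refine (norm_sum_le _ _).trans (Finset.sum_le_sum fun k _ => ?_)
        simp [norm_exp_char]
      linarith)
    hE
  refine ⟨d, hd, fun θ => ?_⟩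
  have := (hs θ).tsum_eq
  rw [this]
  simp
end

section
/- Corollary 2.1: Let p : ℕ → ℝ with p_i ≥ 0 and Σ_{i=0}^∞ p_i = 1, and let G(z) = Σ_{i=0}^∞ p_i z^i for complex |z| ≤ 1. If G(z) ≠ 0 for all complex z with |z| ≤ 1, then for every integer k ≥ 1 there exists q : ℕ → ℝ with Σ_{i=0}^∞ |q_i| < ∞ and Σ_{i=0}^∞ q_i = 1 such that (Σ_{i=0}^∞ q_i z^i)^k = G(z) for all complex z with |z| ≤ 1. -/
open PowerSeries Filter Topology

/-- absolute summability of coefficients -/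
def AbsSumm {𝕜 : Type} [RCLike 𝕜] (f : PowerSeries 𝕜) : Prop := Summable fun n => ‖coeff n f‖

lemma AbsSumm.mul {𝕜 : Type} [RCLike 𝕜] {f g : PowerSeries 𝕜} (hf : AbsSumm f) (hg : AbsSumm g) :
    AbsSumm (f * g) := by
  unfold AbsSumm at *
  have h := summable_norm_sum_mul_antidiagonal_of_summable_norm
    (f := fun n => coeff n f) (g := fun n => coeff n g) hf hg
  refine h.congr fun n => ?_
  rw [coeff_mul]

lemma AbsSumm.add {𝕜 : Type} [RCLike 𝕜] {f g : PowerSeries 𝕜} (hf : AbsSumm f) (hg : AbsSumm g) :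
    AbsSumm (f + g) := by
  unfold AbsSumm at *
  refine Summable.of_nonneg_of_le (fun _ => norm_nonneg _) (fun n => ?_) (Summable.add hf hg)
  rw [map_add]
  exact norm_add_le _ _

lemma AbsSumm.algebraMap {𝕜 : Type} [RCLike 𝕜] (r : 𝕜) :
    AbsSumm (algebraMap 𝕜 (PowerSeries 𝕜) r) := by
  refine summable_of_ne_finset_zero (s := {0}) ?_
  intro n hn
  have : n ≠ 0 := by simpa using hn
  simp [PowerSeries.algebraMap_apply, coeff_C, this]

/-- Power series with absolutely summable coefficients. -/
noncomputable def wienerAlg (𝕜 : Type) [RCLike 𝕜] : Subalgebra 𝕜 (PowerSeries 𝕜) where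
  carrier := {f | AbsSumm f}
  mul_mem' := AbsSumm.mul
  add_mem' := AbsSumm.add
  algebraMap_mem' := AbsSumm.algebraMap

namespace wienerAlg

variable {𝕜 : Type} [RCLike 𝕜]

lemma summ (f : wienerAlg 𝕜) : Summable fun n => ‖coeff n (f : PowerSeries 𝕜)‖ := f.2

/-- constructor from a summable sequence -/
noncomputable def ofSeq (c : ℕ → 𝕜) (hc : Summable fun n => ‖c n‖) : wienerAlg 𝕜 :=
  ⟨PowerSeries.mk c, by
    change Summable fun n => ‖coeff n (PowerSeries.mk c)‖
    simpa using hc⟩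

@[simp] lemma coeff_ofSeq (c : ℕ → 𝕜) (hc : Summable fun n => ‖c n‖) (n : ℕ) :
    coeff n (ofSeq c hc : PowerSeries 𝕜) = c n := by
  simp [ofSeq]

/-- linear map to little l1 -/
noncomputable def toLp : wienerAlg 𝕜 →ₗ[𝕜] lp (fun _ : ℕ => 𝕜) 1 where
  toFun f := ⟨fun n => coeff n (f : PowerSeries 𝕜), by
    apply memℓp_gen
    simpa using (wienerAlg.summ f)⟩
  map_add' f g := by ext n; simp; rfl
  map_smul' r f := by ext n; simp

lemma toLp_apply (f : wienerAlg 𝕜) (n : ℕ) :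
    (toLp f : ∀ _ : ℕ, 𝕜) n = coeff n (f : PowerSeries 𝕜) := rfl

lemma toLp_injective : Function.Injective (toLp (𝕜 := 𝕜)) := by
  intro f g h
  ext n
  rw [← toLp_apply, ← toLp_apply, h]

lemma toLp_surjective : Function.Surjective (toLp (𝕜 := 𝕜)) := by
  intro x
  have hx := (lp.memℓp x).summable (by simp)
  refine ⟨ofSeq (fun n => x n) (by simpa using hx), ?_⟩
  ext n
  simp [toLp_apply]

noncomputable instance : NormedAddCommGroup (wienerAlg 𝕜) :=
  NormedAddCommGroup.induced _ _ toLp toLp_injective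

lemma norm_def (f : wienerAlg 𝕜) : ‖f‖ = ∑' n, ‖coeff n (f : PowerSeries 𝕜)‖ := by
  have : ‖f‖ = ‖toLp f‖ := rfl
  rw [this, lp.norm_eq_tsum_rpow (by simp)]
  simp [toLp_apply]

lemma norm_mul_le' (f g : wienerAlg 𝕜) : ‖f * g‖ ≤ ‖f‖ * ‖g‖ := by
  rw [norm_def, norm_def, norm_def,
    tsum_mul_tsum_eq_tsum_sum_antidiagonal_of_summable_norm (by simpa using (wienerAlg.summ f))
      (by simpa using (wienerAlg.summ g))]
  refine Summable.tsum_le_tsum (fun n => ?_) (wienerAlg.summ (f * g)) ?_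
  · simp only [MulMemClass.coe_mul, coeff_mul]
    refine (norm_sum_le _ _).trans ?_
    simp
  · have := summable_norm_sum_mul_antidiagonal_of_summable_norm
      (f := fun n => ‖coeff n (f : PowerSeries 𝕜)‖) (g := fun n => ‖coeff n (g : PowerSeries 𝕜)‖)
      (by simpa using (wienerAlg.summ f)) (by simpa using (wienerAlg.summ g))
    exact this.of_norm

noncomputable instance : NormedCommRing (wienerAlg 𝕜) where
  __ := (inferInstance : NormedAddCommGroup (wienerAlg 𝕜))
  __ := (inferInstance : CommRing (wienerAlg 𝕜))
  norm_mul_le := norm_mul_le'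

noncomputable instance : NormedAlgebra 𝕜 (wienerAlg 𝕜) where
  __ := (inferInstance : Algebra 𝕜 (wienerAlg 𝕜))
  norm_smul_le r f := by
    rw [norm_def, norm_def, ← tsum_mul_left]
    simp

instance : NormOneClass (wienerAlg 𝕜) where
  norm_one := by
    rw [norm_def, tsum_eq_single 0]
    · simp
    · intro n hn
      simp [coeff_one, hn]

instance : CompleteSpace (wienerAlg 𝕜) := by
  have hi : Isometry (toLp (𝕜 := 𝕜)) :=
    AddMonoidHomClass.isometry_of_norm (toLp (𝕜 := 𝕜)) (fun f => rfl)
  have hr : IsComplete (Set.range (toLp (𝕜 := 𝕜))) := by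
    rw [toLp_surjective.range_eq]
    exact isComplete_univ
  exact (completeSpace_iff_isComplete_range hi.isUniformInducing).2 hr

lemma norm_coeff_le (f : wienerAlg 𝕜) (n : ℕ) : ‖coeff n (f : PowerSeries 𝕜)‖ ≤ ‖f‖ := by
  rw [norm_def]
  exact (wienerAlg.summ f).le_tsum n (fun _ _ => norm_nonneg _)

/-- coefficient as a continuous linear map -/
noncomputable def coeffL (n : ℕ) : wienerAlg 𝕜 →L[𝕜] 𝕜 :=
  LinearMap.mkContinuous ((coeff n).comp (wienerAlg 𝕜).val.toLinearMap) 1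
    (fun f => by simpa using norm_coeff_le f n)

lemma coeffL_apply (n : ℕ) (f : wienerAlg 𝕜) : coeffL n f = coeff n (f : PowerSeries 𝕜) := rfl

/-- The variable -/
noncomputable def var : wienerAlg 𝕜 := ⟨X, by
    change Summable fun n => ‖coeff n (X : PowerSeries 𝕜)‖
    refine summable_of_ne_finset_zero (s := {1}) ?_
    intro n hn
    have : n ≠ 1 := by simpa using hn
    simp [coeff_X, this]⟩

lemma coeff_var_pow (m n : ℕ) :
    coeff n ((var ^ m : wienerAlg 𝕜) : PowerSeries 𝕜) = if n = m then 1 else 0 := by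
  simp [var, coeff_X_pow]

lemma norm_var_pow (m : ℕ) : ‖(var ^ m : wienerAlg 𝕜)‖ = 1 := by
  rw [norm_def, tsum_eq_single m]
  · rw [coeff_var_pow]; simp
  · intro n hn
    rw [coeff_var_pow]; simp [hn]

lemma hasSum_var (f : wienerAlg 𝕜) :
    HasSum (fun n => coeff n (f : PowerSeries 𝕜) • (var ^ n : wienerAlg 𝕜)) f := by
  have hs : Summable (fun n => coeff n (f : PowerSeries 𝕜) • (var ^ n : wienerAlg 𝕜)) := by
    apply Summable.of_norm
    simpa [norm_smul, norm_var_pow] using (wienerAlg.summ f)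
  obtain ⟨g, hg⟩ := hs
  have : g = f := by
    ext m
    have h1 := hg.mapL (coeffL m)
    simp only [map_smul, coeffL_apply, coeff_var_pow] at h1
    rw [← coeffL_apply]
    refine h1.unique ?_
    convert hasSum_ite_eq m (coeff m (f : PowerSeries 𝕜)) using 2 with n
    by_cases h : n = m
    · simp [h]
    · simp [h, Ne.symm h]
  rwa [this] at hg

/-- Wiener lemma -/
lemma isUnit_complex (f : wienerAlg ℂ)
    (h : ∀ z : ℂ, ‖z‖ ≤ 1 → (∑' i, coeff i (f : PowerSeries ℂ) * z ^ i) ≠ 0) : IsUnit f := by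
  by_contra hf
  obtain ⟨φ, hφ⟩ := WeakDual.CharacterSpace.exists_apply_eq_zero hf
  have hz : ‖φ var‖ ≤ 1 := by
    have := spectrum.norm_le_norm_of_mem (AlgHom.apply_mem_spectrum φ (var : wienerAlg ℂ))
    have h1 := norm_var_pow (𝕜 := ℂ) 1
    rw [pow_one] at h1
    rwa [h1] at this
  refine h _ hz ?_
  have h2 := (hasSum_var f).map φ (map_continuous φ)
  rw [hφ] at h2
  refine HasSum.tsum_eq ?_
  convert h2 using 2 with n
  simp

/-- Wiener lemma, real coefficients -/
lemma isUnit_real (f : wienerAlg ℝ)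
    (h : ∀ z : ℂ, ‖z‖ ≤ 1 → (∑' i, ((coeff i (f : PowerSeries ℝ) : ℝ) : ℂ) * z ^ i) ≠ 0) :
    IsUnit f := by
  have hu := isUnit_complex (ofSeq (fun n => ((coeff n (f : PowerSeries ℝ) : ℝ) : ℂ))
    (by simpa using (wienerAlg.summ f))) (by simpa using h)
  obtain ⟨g, hg⟩ := hu.exists_right_inv
  have hgs : Summable fun n => ‖(coeff n (g : PowerSeries ℂ)).re‖ :=
    Summable.of_nonneg_of_le (fun _ => norm_nonneg _) (fun n => Complex.abs_re_le_norm _) (wienerAlg.summ g)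
  refine IsUnit.of_mul_eq_one (ofSeq _ hgs) ?_
  ext n
  have := congrArg (fun x : wienerAlg ℂ => (coeff n (x : PowerSeries ℂ)).re) hg
  simp only [MulMemClass.coe_mul, coeff_mul, coeff_ofSeq, Complex.re_sum, OneMemClass.coe_one,
    coeff_one, Complex.re_ofReal_mul] at this ⊢
  rw [this]
  split_ifs <;> simp

/-- dilation -/
noncomputable def dil (t : ℝ) (ht : |t| ≤ 1) : wienerAlg ℝ →* wienerAlg ℝ where
  toFun f := ⟨rescale t (f : PowerSeries ℝ), by
    change Summable fun n => ‖coeff n (rescale t (f : PowerSeries ℝ))‖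
    refine Summable.of_nonneg_of_le (fun _ => norm_nonneg _) (fun n => ?_) (wienerAlg.summ f)
    rw [coeff_rescale, norm_mul, norm_pow]
    exact mul_le_of_le_one_left (norm_nonneg _) (pow_le_one₀ (norm_nonneg _) ht)⟩
  map_one' := by ext; simp
  map_mul' f g := by ext; simp

lemma coeff_dil (t : ℝ) (ht : |t| ≤ 1) (f : wienerAlg ℝ) (n : ℕ) :
    coeff n (dil t ht f : PowerSeries ℝ) = t ^ n * coeff n (f : PowerSeries ℝ) := by
  simp [dil]

lemma abs_le_one_of_Icc (t : Set.Icc (0 : ℝ) 1) : |(t : ℝ)| ≤ 1 :=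
  abs_le.2 ⟨by linarith [t.2.1], t.2.2⟩

lemma continuous_dil (f : wienerAlg ℝ) :
    Continuous fun t : Set.Icc (0 : ℝ) 1 => dil t (abs_le_one_of_Icc t) f := by
  rw [continuous_iff_continuousAt]
  intro s
  unfold ContinuousAt
  rw [tendsto_iff_norm_sub_tendsto_zero]
  have hc : Continuous fun t : Set.Icc (0 : ℝ) 1 =>
      ∑' n, ‖(t : ℝ) ^ n * coeff n (f : PowerSeries ℝ) - (s : ℝ) ^ n * coeff n (f : PowerSeries ℝ)‖ := by
    refine continuous_tsum (u := fun n => 2 * ‖coeff n (f : PowerSeries ℝ)‖) (fun n => by fun_prop)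
      ((wienerAlg.summ f).mul_left 2) ?_
    intro n t
    rw [norm_norm]
    refine (norm_sub_le _ _).trans ?_
    rw [norm_mul, norm_mul, norm_pow, norm_pow, ← add_mul]
    refine mul_le_mul_of_nonneg_right ?_ (norm_nonneg _)
    have h1 := pow_le_one₀ (n := n) (norm_nonneg (t : ℝ)) (abs_le_one_of_Icc t)
    have h2 := pow_le_one₀ (n := n) (norm_nonneg (s : ℝ)) (abs_le_one_of_Icc s)
    linarith
  have := hc.tendsto s
  simp only [sub_self, norm_zero, tsum_zero] at this
  refine this.congr fun t => ?_
  rw [norm_def]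
  simp [coeff_dil]

lemma pow_nhds (k : ℕ) (hk : 1 ≤ k) : ∀ᶠ y in 𝓝 (1 : wienerAlg ℝ), ∃ x, x ^ k = y := by
  have h := (hasStrictFDerivAt_id (𝕜 := ℝ) (1 : wienerAlg ℝ)).pow k
  have h2 := h.map_nhds_eq_of_surj (by
    rw [LinearMap.range_eq_top]
    intro y
    refine ⟨((k : ℝ)⁻¹) • y, ?_⟩
    have : (k : ℝ) ≠ 0 := by positivity
    simp [Algebra.smul_def]
    rw [← mul_assoc, ← map_natCast (algebraMap ℝ (wienerAlg ℝ)), ← map_mul, mul_inv_cancel₀ this]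
    simp)
  simp only [id, one_pow] at h2
  rw [← h2, Filter.eventually_map]
  exact Filter.Eventually.of_forall fun x => ⟨x, rfl⟩

lemma exists_root (f : wienerAlg ℝ) (hf : IsUnit f) (h0 : 0 ≤ coeff 0 (f : PowerSeries ℝ))
    (k : ℕ) (hk : 1 ≤ k) : ∃ g, g ^ k = f := by
  obtain ⟨u, rfl⟩ := hf
  let H : Subgroup (wienerAlg ℝ)ˣ := (powMonoidHom k).range
  have hmem : ∀ v : (wienerAlg ℝ)ˣ, (∃ x, x ^ k = (v : wienerAlg ℝ)) → v ∈ H := by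
    rintro v ⟨x, hx⟩
    have hxu : IsUnit x := (isUnit_pow_iff (by omega)).1 (hx ▸ v.isUnit)
    obtain ⟨w, rfl⟩ := hxu
    exact ⟨w, Units.ext (by simpa using hx)⟩
  have hopen : IsOpen (H : Set (wienerAlg ℝ)ˣ) := by
    refine H.isOpen_of_mem_nhds (g := 1) ?_
    have hc : Tendsto (fun v : (wienerAlg ℝ)ˣ => (v : wienerAlg ℝ)) (𝓝 1) (𝓝 1) := by
      simpa using (Units.continuous_val (M := wienerAlg ℝ)).tendsto 1
    filter_upwards [hc.eventually (pow_nhds k hk)] with v hv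
    exact hmem v hv
  have hclopen : IsClopen (H : Set (wienerAlg ℝ)ˣ) := ⟨H.isClosed_of_isOpen hopen, hopen⟩
  let γ : Set.Icc (0 : ℝ) 1 → (wienerAlg ℝ)ˣ := fun t => Units.map (dil t (abs_le_one_of_Icc t)) u
  have hγ : Continuous γ := by
    rw [Units.continuous_iff]
    exact ⟨continuous_dil _, continuous_dil (u⁻¹ : (wienerAlg ℝ)ˣ)⟩
  have h0' : γ ⟨0, by simp⟩ ∈ H := by
    apply hmem
    refine ⟨algebraMap ℝ _ ((coeff 0 ((u : wienerAlg ℝ) : PowerSeries ℝ)) ^ ((k : ℝ)⁻¹)), ?_⟩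
    rw [← map_pow, Real.rpow_inv_natCast_pow h0 (by omega)]
    ext n
    simp only [γ, Units.coe_map, MonoidHom.coe_coe]
    rw [coeff_dil]
    rcases n with _ | n <;> simp [PowerSeries.algebraMap_apply, coeff_C]
  have hall := (isClopen_univ_of hclopen hγ h0')
  obtain ⟨w, hw⟩ := hall ⟨1, by simp⟩
  refine ⟨w, ?_⟩
  have hw' := congrArg (fun v : (wienerAlg ℝ)ˣ => (v : wienerAlg ℝ)) hw
  simp only [powMonoidHom_apply, Units.val_pow_eq_pow_val] at hw'
  rw [hw']
  ext n
  simp only [γ, Units.coe_map, MonoidHom.coe_coe]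
  rw [coeff_dil]
  simp
where
  isClopen_univ_of {H : Set (wienerAlg ℝ)ˣ} (hH : IsClopen H)
      {γ : Set.Icc (0 : ℝ) 1 → (wienerAlg ℝ)ˣ} (hγ : Continuous γ) {a : Set.Icc (0 : ℝ) 1}
      (ha : γ a ∈ H) : ∀ t, γ t ∈ H := by
    intro t
    have := (hH.preimage hγ).eq_univ ⟨a, ha⟩
    exact (this ▸ Set.mem_univ t : t ∈ Set.preimage γ H)

/-- evaluation at a complex point -/
noncomputable def ev (z : ℂ) (f : wienerAlg ℝ) : ℂ :=
  ∑' i, ((coeff i (f : PowerSeries ℝ) : ℝ) : ℂ) * z ^ i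

lemma ev_mul (z : ℂ) (hz : ‖z‖ ≤ 1) (f g : wienerAlg ℝ) : ev z (f * g) = ev z f * ev z g := by
  have hs : ∀ f : wienerAlg ℝ,
      Summable fun i => ‖((coeff i (f : PowerSeries ℝ) : ℝ) : ℂ) * z ^ i‖ := by
    intro f
    refine Summable.of_nonneg_of_le (fun _ => norm_nonneg _) (fun n => ?_) (wienerAlg.summ f)
    rw [norm_mul, norm_pow, Complex.norm_real]
    exact mul_le_of_le_one_right (norm_nonneg _) (pow_le_one₀ (norm_nonneg _) hz)
  unfold ev
  rw [tsum_mul_tsum_eq_tsum_sum_antidiagonal_of_summable_norm (hs f) (hs g)]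
  congr 1
  ext n
  simp only [MulMemClass.coe_mul, coeff_mul, Complex.ofReal_sum, Complex.ofReal_mul,
    Finset.sum_mul]
  refine Finset.sum_congr rfl fun x hx => ?_
  rw [← Finset.HasAntidiagonal.mem_antidiagonal.1 hx, pow_add]
  ring

lemma ev_one (z : ℂ) : ev z 1 = 1 := by
  unfold ev
  rw [tsum_eq_single 0]
  · simp
  · intro n hn
    simp [coeff_one, hn]

lemma ev_pow (z : ℂ) (hz : ‖z‖ ≤ 1) (f : wienerAlg ℝ) (k : ℕ) : ev z (f ^ k) = ev z f ^ k := by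
  induction k with
  | zero => simp [ev_one]
  | succ k ih => rw [pow_succ, ev_mul z hz, ih, pow_succ]

end wienerAlg

/-- Corollary 2.1: if the p.g.f. of a discrete probability distribution has no
zero on the closed unit disk, then every k-th root of the p.g.f. is again a
signed p.g.f. with absolutely convergent coefficients summing to 1. -/
theorem pgf_ne_zero_kth_root
    (p : ℕ → ℝ) (hp : ∀ i, 0 ≤ p i) (hp1 : (∑' i, p i) = 1)
    (hne : ∀ z : ℂ, ‖z‖ ≤ 1 → (∑' i, (p i : ℂ) * z ^ i) ≠ 0) :
    ∀ k : ℕ, 1 ≤ k → ∃ q : ℕ → ℝ,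
      Summable (fun i => |q i|) ∧ (∑' i, q i) = 1 ∧
      ∀ z : ℂ, ‖z‖ ≤ 1 →
        (∑' i, (q i : ℂ) * z ^ i) ^ k = ∑' i, (p i : ℂ) * z ^ i := by
  intro k hk
  have hs : Summable p := by
    by_contra h
    rw [tsum_eq_zero_of_not_summable h] at hp1
    exact zero_ne_one hp1
  have hsn : Summable fun n => ‖p n‖ := hs.norm
  have hu := wienerAlg.isUnit_real (wienerAlg.ofSeq p hsn) (by simpa using hne)
  obtain ⟨g, hg⟩ := wienerAlg.exists_root _ hu (by simpa using hp 0) k hk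
  have hev : ∀ z : ℂ, ‖z‖ ≤ 1 →
      (∑' i, ((coeff i (g : PowerSeries ℝ) : ℝ) : ℂ) * z ^ i) ^ k = ∑' i, (p i : ℂ) * z ^ i := by
    intro z hz
    have := wienerAlg.ev_pow z hz g k
    rw [hg] at this
    unfold wienerAlg.ev at this
    rw [← this]
    simp
  have h1 : (∑' i, coeff i (g : PowerSeries ℝ)) ^ k = 1 := by
    have := hev 1 (by simp)
    simp only [one_pow, mul_one, ← Complex.ofReal_tsum, hp1] at this
    exact_mod_cast this
  have habs : |∑' i, coeff i (g : PowerSeries ℝ)| = 1 := by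
    have : |∑' i, coeff i (g : PowerSeries ℝ)| ^ k = 1 := by rw [← abs_pow, h1, abs_one]
    exact (pow_eq_one_iff_of_nonneg (abs_nonneg _) (by omega)).1 this
  rcases eq_or_eq_neg_of_abs_eq habs with h | h
  · exact ⟨fun i => coeff i (g : PowerSeries ℝ), (wienerAlg.summ g), h, hev⟩
  · have hkk : (-1 : ℝ) ^ k = 1 := by rwa [h] at h1
    have hkc : (-1 : ℂ) ^ k = 1 := by exact_mod_cast congrArg (fun x : ℝ => (x : ℂ)) hkk
    refine ⟨fun i => -coeff i (g : PowerSeries ℝ), by simpa using (wienerAlg.summ g), ?_, ?_⟩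
    · rw [tsum_neg, h, neg_neg]
    · intro z hz
      rw [← hev z hz]
      simp only [Complex.ofReal_neg, neg_mul, tsum_neg]
      rw [neg_pow, hkc, one_mul]
end

section
/- Lemma 2.6: For every ν with 0 < ν ≤ 1 and every x ∈ ℝ, the Mittag-Leffler function value E_ν(x) = Σ_{m=0}^∞ x^m / Γ(νm + 1) is nonzero, i.e. E_ν(x) ≠ 0 for all real x. -/
open MeasureTheory Set Filter Topology

lemma ml_beta_real (a b : ℝ) (ha : 0 < a) (hb : 0 < b) :
    ∫ s in (0:ℝ)..1, s ^ (a - 1) * (1 - s) ^ (b - 1) =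
      Real.Gamma a * Real.Gamma b / Real.Gamma (a + b) := by
  have h := Complex.betaIntegral_eq_Gamma_mul_div (a : ℂ) (b : ℂ) (by simpa) (by simpa)
  rw [← Complex.ofReal_add, Complex.Gamma_ofReal, Complex.Gamma_ofReal, Complex.Gamma_ofReal] at h
  have h2 : Complex.betaIntegral a b =
      ((∫ s in (0:ℝ)..1, s ^ (a - 1) * (1 - s) ^ (b - 1) : ℝ) : ℂ) := by
    rw [Complex.betaIntegral, ← intervalIntegral.integral_ofReal]
    apply intervalIntegral.integral_congr
    intro s hs
    rw [uIcc_of_le zero_le_one] at hs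
    simp only
    push_cast [Complex.ofReal_cpow hs.1, Complex.ofReal_cpow (sub_nonneg.2 hs.2)]
    rfl
  rw [h2] at h
  exact_mod_cast h

lemma ml_bern (c : ℝ) (hc : 0 < c) (s : ℝ) (hs0 : 0 ≤ s) (hs1 : s ≤ 1) :
    1 - s ^ c ≤ (1 + c) * (1 - s) := by
  rcases le_total c 1 with h | h
  · have : s ≤ s ^ c := by
      rcases hs0.eq_or_lt with h0 | h0
      · rw [← h0, Real.zero_rpow hc.ne']
      · simpa using Real.rpow_le_rpow_of_exponent_ge h0 hs1 h
    nlinarith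
  · have := one_add_mul_self_le_rpow_one_add (s := s - 1) (by linarith) h
    rw [add_sub_cancel] at this
    nlinarith

lemma ml_integrable (ν c : ℝ) (h0 : 0 < ν) (h1 : ν < 1) (hc : 0 < c) :
    IntervalIntegrable (fun s : ℝ => (1 - s ^ c) * (1 - s) ^ (-ν - 1)) volume 0 1 := by
  have hb : IntervalIntegrable (fun s : ℝ => (1 + c) * (1 - s) ^ (-ν)) volume 0 1 := by
    apply IntervalIntegrable.const_mul
    have := (intervalIntegral.intervalIntegrable_rpow' (a := 0) (b := 1)
      (show -1 < -ν by linarith)).comp_sub_left 1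
    simpa using this.symm
  rw [intervalIntegrable_iff_integrableOn_Ioo_of_le zero_le_one] at hb ⊢
  refine Integrable.mono' hb (by fun_prop) ?_
  rw [ae_restrict_iff' measurableSet_Ioo]
  refine Eventually.of_forall fun s hs => ?_
  have p : 0 < 1 - s := sub_pos.2 hs.2
  have q : s ^ c ≤ 1 := Real.rpow_le_one hs.1.le hs.2.le hc.le
  rw [Real.norm_of_nonneg (mul_nonneg (by linarith) (by positivity))]
  have e : (1 - s) ^ (-ν) = (1 - s) * (1 - s) ^ (-ν - 1) := by
    rw [mul_comm, ← Real.rpow_add_one p.ne']; ring_nf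
  rw [e, ← mul_assoc]
  exact mul_le_mul_of_nonneg_right (ml_bern c hc s hs.1.le hs.2.le) (by positivity)

lemma ml_key (ν c : ℝ) (h0 : 0 < ν) (h1 : ν < 1) (hc : 0 < c) :
    1 + ν * ∫ s in (0:ℝ)..1, (1 - s ^ c) * (1 - s) ^ (-ν - 1) =
      Real.Gamma (1 - ν) * Real.Gamma (c + 1) / Real.Gamma (c - ν + 1) := by
  have hB := ml_beta_real c (1 - ν) hc (by linarith)
  have hne : ∫ s in (0:ℝ)..1, s ^ (c - 1) * (1 - s) ^ (1 - ν - 1) ≠ 0 := by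
    rw [hB]
    have := Real.Gamma_pos_of_pos hc
    have := Real.Gamma_pos_of_pos (show 0 < 1 - ν by linarith)
    have := Real.Gamma_pos_of_pos (show 0 < c + (1 - ν) by linarith)
    positivity
  have hI : IntervalIntegrable (fun s : ℝ => s ^ (c - 1) * (1 - s) ^ (1 - ν - 1)) volume 0 1 := by
    by_contra h
    exact hne (intervalIntegral.integral_undef h)
  have hJ := ml_integrable ν c h0 h1 hc
  have hF := intervalIntegral.integral_eq_sub_of_hasDerivAt_of_le (a := (0:ℝ)) (b := 1)
    (f := fun s : ℝ => (1 - s ^ c) * (1 - s) ^ (-ν))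
    (f' := fun s : ℝ => ν * ((1 - s ^ c) * (1 - s) ^ (-ν - 1))
      - c * (s ^ (c - 1) * (1 - s) ^ (1 - ν - 1))) zero_le_one ?_ ?_
      ((hJ.const_mul ν).sub (hI.const_mul c))
  · rw [intervalIntegral.integral_sub (hJ.const_mul ν) (hI.const_mul c),
      intervalIntegral.integral_const_mul, intervalIntegral.integral_const_mul, hB] at hF
    simp only [Real.one_rpow, sub_self, zero_mul, Real.zero_rpow hc.ne', sub_zero, mul_one] at hF
    rw [Real.Gamma_add_one hc.ne', show c - ν + 1 = c + (1 - ν) by ring]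
    have : Real.Gamma (1 - ν) * (c * Real.Gamma c) / Real.Gamma (c + (1 - ν)) =
      c * (Real.Gamma c * Real.Gamma (1 - ν) / Real.Gamma (c + (1 - ν))) := by ring
    rw [this]; linarith
  · intro s hs
    rcases hs.2.eq_or_lt with h | h
    · subst h
      have hlim : Tendsto (fun s : ℝ => (1 + c) * (1 - s) ^ (1 - ν)) (𝓝[Icc 0 1] 1) (𝓝 0) := by
        have : ContinuousAt (fun s : ℝ => (1 + c) * (1 - s) ^ (1 - ν)) 1 := by
          apply ContinuousAt.mul continuousAt_const
          apply ContinuousAt.rpow_const (by fun_prop)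
          right; linarith
        have h2 := this.tendsto
        simp only [sub_self, Real.zero_rpow (show 1 - ν ≠ 0 by linarith), mul_zero] at h2
        exact h2.mono_left nhdsWithin_le_nhds
      unfold ContinuousWithinAt
      simp only [Real.one_rpow, sub_self, zero_mul]
      refine tendsto_of_tendsto_of_tendsto_of_le_of_le' tendsto_const_nhds hlim ?_ ?_
      · filter_upwards [self_mem_nhdsWithin] with t ht
        exact mul_nonneg (sub_nonneg.2 (Real.rpow_le_one ht.1 ht.2 hc.le))
          (Real.rpow_nonneg (sub_nonneg.2 ht.2) _)
      · filter_upwards [self_mem_nhdsWithin] with t ht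
        rcases ht.2.eq_or_lt with h | h
        · subst h; simp [Real.zero_rpow (show 1 - ν ≠ 0 by linarith)]
        have e : (1 - t) ^ (1 - ν) = (1 - t) * (1 - t) ^ (-ν) := by
          rw [mul_comm, ← Real.rpow_add_one (by linarith)]; ring_nf
        rw [e, ← mul_assoc]
        exact mul_le_mul_of_nonneg_right (ml_bern c hc t ht.1 ht.2)
          (Real.rpow_nonneg (sub_nonneg.2 ht.2) _)
    · apply ContinuousAt.continuousWithinAt
      apply ContinuousAt.mul
      · exact continuousAt_const.sub (continuousAt_id.rpow_const (Or.inr hc.le))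
      · apply ContinuousAt.rpow_const (by fun_prop)
        left; linarith
  · intro s hs
    have d1 := (Real.hasDerivAt_rpow_const (x := s) (p := c) (Or.inl hs.1.ne')).const_sub 1
    have d2 := ((hasDerivAt_id s).const_sub 1).rpow_const (p := -ν)
      (Or.inl (by simp only [id]; linarith [hs.2]))
    refine (d1.mul d2).congr_deriv ?_
    simp only [id, show 1 - ν - 1 = -ν by ring]
    ring

lemma ml_gamma_lower (R z : ℝ) (hR : 0 < R) (hz : 1 ≤ z) :
    R ^ (z - 1) * Real.exp (-R) ≤ Real.Gamma z := by
  rw [Real.Gamma_eq_integral (by linarith), ← integral_exp_neg_Ioi R, ← integral_const_mul]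
  have hg := Real.GammaIntegral_convergent (s := z) (by linarith)
  have hsub : Ioi R ⊆ Ioi (0:ℝ) := Ioi_subset_Ioi hR.le
  calc _ ≤ ∫ x in Ioi R, Real.exp (-x) * x ^ (z - 1) := by
        refine setIntegral_mono_on ((integrableOn_exp_neg_Ioi R).const_mul _) (hg.mono_set hsub)
          measurableSet_Ioi fun x hx => ?_
        rw [mul_comm]
        exact mul_le_mul_of_nonneg_left
          (Real.rpow_le_rpow hR.le (le_of_lt hx) (by linarith)) (Real.exp_pos _).le
    _ ≤ _ := by
        refine setIntegral_mono_set hg ?_ hsub.eventuallyLE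
        rw [EventuallyLE, ae_restrict_iff' measurableSet_Ioi]
        refine Eventually.of_forall fun x hx => ?_
        have : 0 < x := hx
        simp only [Pi.zero_apply]
        positivity

lemma ml_summable (ν : ℝ) (h0 : 0 < ν) (y : ℝ) :
    Summable fun m : ℕ => y ^ m / Real.Gamma (ν * m + 1) := by
  obtain ⟨R, hR, hRy⟩ : ∃ R : ℝ, 0 < R ∧ R ^ ν = 2 * (|y| + 1) := by
    refine ⟨(2 * (|y| + 1)) ^ (1 / ν), by positivity, ?_⟩
    rw [← Real.rpow_mul (by positivity), one_div_mul_cancel h0.ne', Real.rpow_one]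
  refine Summable.of_norm_bounded (g := fun m : ℕ => Real.exp R * (1 / 2 : ℝ) ^ m)
    (summable_geometric_two.mul_left _) fun m => ?_
  have hg := ml_gamma_lower R (ν * m + 1) hR (by have : 0 ≤ ν * m := by positivity
                                                 linarith)
  rw [add_sub_cancel_right, Real.rpow_mul hR.le, hRy, Real.rpow_natCast, Real.exp_neg] at hg
  have hG : 0 < Real.Gamma (ν * m + 1) := Real.Gamma_pos_of_pos (by positivity)
  rw [norm_div, norm_pow, Real.norm_eq_abs, Real.norm_of_nonneg hG.le, div_le_iff₀ hG]
  have : |y| ^ m ≤ (|y| + 1) ^ m := pow_le_pow_left₀ (abs_nonneg _) (by linarith) m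
  refine this.trans ?_
  calc (|y| + 1) ^ m = Real.exp R * (1 / 2) ^ m * ((2 * (|y| + 1)) ^ m * (Real.exp R)⁻¹) := by
        rw [mul_pow, one_div, inv_pow]
        have := Real.exp_pos R
        field_simp
    _ ≤ _ := by gcongr

lemma ml_continuousOn (ν : ℝ) (h0 : 0 < ν) (r : ℝ) :
    ContinuousOn (fun x : ℝ => ∑' m : ℕ, x ^ m / Real.Gamma (ν * m + 1)) (Icc r 0) := by
  refine continuousOn_tsum (fun m => by fun_prop) (ml_summable ν h0 |r|) fun m x hx => ?_
  have hG : 0 < Real.Gamma (ν * m + 1) := Real.Gamma_pos_of_pos (by positivity)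
  rw [norm_div, norm_pow, Real.norm_eq_abs, Real.norm_of_nonneg hG.le]
  have : |x| ≤ |r| := by
    rw [abs_of_nonpos hx.2, abs_of_nonpos (hx.1.trans hx.2)]; linarith [hx.1]
  gcongr

/-- The minimum principle: the main identity at a point `x`. -/
lemma ml_identity (ν : ℝ) (h0 : 0 < ν) (h1 : ν < 1) (x : ℝ) :
    (∑' m : ℕ, x ^ m / Real.Gamma (ν * m + 1)) - 1
      + ν * ∫ s in Ioo (0:ℝ) 1, ((∑' m : ℕ, x ^ m / Real.Gamma (ν * m + 1))
        - ∑' m : ℕ, (x * s ^ ν) ^ m / Real.Gamma (ν * m + 1)) * (1 - s) ^ (-ν - 1)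
      = Real.Gamma (1 - ν) * (x * ∑' m : ℕ, x ^ m / Real.Gamma (ν * m + 1)) := by
  set J : ℕ → ℝ := fun m =>
    ∫ s in Ioo (0:ℝ) 1, (1 - s ^ (ν * ((m + 1 : ℕ) : ℝ))) * (1 - s) ^ (-ν - 1) with hJdef
  have hpos : ∀ m : ℕ, 0 < ν * ((m + 1 : ℕ) : ℝ) := fun m => by positivity
  have hG : ∀ m : ℕ, 0 < Real.Gamma (ν * m + 1) := fun m => Real.Gamma_pos_of_pos (by positivity)
  have hG1 : 0 < Real.Gamma (1 - ν) := Real.Gamma_pos_of_pos (by linarith)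
  have hkey : ∀ m : ℕ, 1 + ν * J m = Real.Gamma (1 - ν) *
      Real.Gamma (ν * ((m + 1 : ℕ) : ℝ) + 1) / Real.Gamma (ν * m + 1) := by
    intro m
    have := ml_key ν _ h0 h1 (hpos m)
    rw [intervalIntegral.integral_of_le zero_le_one, integral_Ioc_eq_integral_Ioo] at this
    simp only [hJdef]
    rw [this]
    congr 2
    push_cast; ring
  have hJnn : ∀ m, 0 ≤ J m := by
    intro m
    refine setIntegral_nonneg measurableSet_Ioo fun s hs => ?_
    exact mul_nonneg (sub_nonneg.2 (Real.rpow_le_one hs.1.le hs.2.le (hpos m).le))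
          (Real.rpow_nonneg (sub_nonneg.2 hs.2.le) _)
  have hterm : ∀ (m : ℕ) (y : ℝ), y ^ (m + 1) / Real.Gamma (ν * ((m + 1 : ℕ) : ℝ) + 1)
      + ν * (y ^ (m + 1) / Real.Gamma (ν * ((m + 1 : ℕ) : ℝ) + 1) * J m)
      = Real.Gamma (1 - ν) * (y * (y ^ m / Real.Gamma (ν * m + 1))) := by
    intro m y
    have e : y ^ (m + 1) / Real.Gamma (ν * ((m + 1 : ℕ) : ℝ) + 1)
      + ν * (y ^ (m + 1) / Real.Gamma (ν * ((m + 1 : ℕ) : ℝ) + 1) * J m)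
      = y ^ (m + 1) / Real.Gamma (ν * ((m + 1 : ℕ) : ℝ) + 1) * (1 + ν * J m) := by ring
    rw [e, hkey]
    have := hG m
    have := hG (m + 1)
    field_simp
    ring
  -- summability of the integrated series
  have hS : ∀ y : ℝ, Summable fun m : ℕ =>
      y ^ (m + 1) / Real.Gamma (ν * ((m + 1 : ℕ) : ℝ) + 1) := fun y =>
    (summable_nat_add_iff 1).2 (ml_summable ν h0 y)
  have hSJ : ∀ y : ℝ, Summable fun m : ℕ =>
      y ^ (m + 1) / Real.Gamma (ν * ((m + 1 : ℕ) : ℝ) + 1) * J m := by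
    intro y
    have h := ((((ml_summable ν h0 y).mul_left y).mul_left (Real.Gamma (1 - ν))).sub
      (hS y)).mul_left ν⁻¹
    refine h.congr fun m => ?_
    rw [← hterm m y]
    field_simp
    ring
  have hsplit : ∀ y : ℝ, ∑' m : ℕ, y ^ m / Real.Gamma (ν * m + 1) =
      1 + ∑' m : ℕ, y ^ (m + 1) / Real.Gamma (ν * ((m + 1 : ℕ) : ℝ) + 1) := by
    intro y
    rw [(ml_summable ν h0 y).tsum_eq_zero_add]
    simp
  let F : ℕ → ℝ → ℝ := fun m s =>
    x ^ (m + 1) / Real.Gamma (ν * ((m + 1 : ℕ) : ℝ) + 1) *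
      ((1 - s ^ (ν * ((m + 1 : ℕ) : ℝ))) * (1 - s) ^ (-ν - 1))
  have hFi : ∀ m, Integrable (F m) (volume.restrict (Ioo (0:ℝ) 1)) := by
    intro m
    have := ml_integrable ν _ h0 h1 (hpos m)
    rw [intervalIntegrable_iff_integrableOn_Ioo_of_le zero_le_one] at this
    exact Integrable.const_mul this _
  have hFn : ∀ m, ∫ s in Ioo (0:ℝ) 1, ‖F m s‖ =
      |x| ^ (m + 1) / Real.Gamma (ν * ((m + 1 : ℕ) : ℝ) + 1) * J m := by
    intro m
    simp only [hJdef]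
    rw [← integral_const_mul]
    refine setIntegral_congr_fun measurableSet_Ioo fun s hs => ?_
    simp only [F]
    rw [norm_mul, norm_div, norm_pow, Real.norm_eq_abs x, Real.norm_of_nonneg (hG (m + 1)).le,
      Real.norm_of_nonneg (mul_nonneg
        (sub_nonneg.2 (Real.rpow_le_one hs.1.le hs.2.le (hpos m).le))
          (Real.rpow_nonneg (sub_nonneg.2 hs.2.le) _))]
  have hsum := hasSum_integral_of_summable_integral_norm hFi ((hSJ |x|).congr fun m => (hFn m).symm)
  have hFJ : ∀ m, ∫ s in Ioo (0:ℝ) 1, F m s =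
      x ^ (m + 1) / Real.Gamma (ν * ((m + 1 : ℕ) : ℝ) + 1) * J m := fun m =>
    integral_const_mul _ _
  have hint : ∫ s in Ioo (0:ℝ) 1, ((∑' m : ℕ, x ^ m / Real.Gamma (ν * m + 1))
        - ∑' m : ℕ, (x * s ^ ν) ^ m / Real.Gamma (ν * m + 1)) * (1 - s) ^ (-ν - 1) =
      ∫ s in Ioo (0:ℝ) 1, ∑' m, F m s := by
    refine setIntegral_congr_fun measurableSet_Ioo fun s hs => ?_
    rw [hsplit x, hsplit, add_sub_add_left_eq_sub, ← (hS x).tsum_sub (hS _), ← tsum_mul_right]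
    refine tsum_congr fun m => ?_
    simp only [F]
    rw [mul_pow, ← Real.rpow_mul_natCast hs.1.le]
    ring
  rw [hint, ← hsum.tsum_eq, tsum_congr hFJ, ← tsum_mul_left, ← tsum_mul_left, ← tsum_mul_left,
    hsplit, add_sub_cancel_left, ← (hS x).tsum_add ((hSJ x).mul_left ν)]
  exact tsum_congr fun m => hterm m x

/-- Lemma 2.6: the one-parameter Mittag-Leffler function
`E_ν(x) = ∑ x^m / Γ(ν m + 1)` has no real zeros for `0 < ν ≤ 1`. -/
theorem mittagLeffler_ne_zero
    (ν : ℝ) (hν0 : 0 < ν) (hν1 : ν ≤ 1) (x : ℝ) :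
    (∑' m : ℕ, x ^ m / Real.Gamma (ν * m + 1)) ≠ 0 := by
  rcases le_total 0 x with hx | hx
  · refine ne_of_gt ((ml_summable ν hν0 x).tsum_pos (fun m => ?_) 0 (by simp))
    have hG : 0 < Real.Gamma (ν * m + 1) := Real.Gamma_pos_of_pos (by positivity)
    positivity
  rcases hν1.eq_or_lt with h | h1
  · subst h
    have : ∑' m : ℕ, x ^ m / Real.Gamma (1 * m + 1) = Real.exp x := by
      rw [Real.exp_eq_exp_ℝ, NormedSpace.exp_eq_tsum_div]
      refine tsum_congr fun m => ?_
      rw [one_mul, Real.Gamma_nat_eq_factorial]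
    rw [this]
    exact (Real.exp_pos x).ne'
  intro hzero
  obtain ⟨y, hy, hmin⟩ := isCompact_Icc.exists_isMinOn (nonempty_Icc.2 hx)
    (ml_continuousOn ν hν0 x)
  have hid := ml_identity ν hν0 h1 y
  have hle : ∑' m : ℕ, y ^ m / Real.Gamma (ν * m + 1) ≤ 0 := by
    have := isMinOn_iff.1 hmin x (left_mem_Icc.2 hx)
    simp only [hzero] at this
    exact this
  have hI : ∫ s in Ioo (0:ℝ) 1, ((∑' m : ℕ, y ^ m / Real.Gamma (ν * m + 1))
        - ∑' m : ℕ, (y * s ^ ν) ^ m / Real.Gamma (ν * m + 1)) * (1 - s) ^ (-ν - 1) ≤ 0 := by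
    refine setIntegral_nonpos measurableSet_Ioo fun s hs => ?_
    refine mul_nonpos_of_nonpos_of_nonneg ?_ (Real.rpow_nonneg (sub_nonneg.2 hs.2.le) _)
    have p1 : s ^ ν ≤ 1 := Real.rpow_le_one hs.1.le hs.2.le hν0.le
    have p0 : 0 ≤ s ^ ν := Real.rpow_nonneg hs.1.le _
    have := isMinOn_iff.1 hmin (y * s ^ ν) ⟨by nlinarith [hy.1, hy.2], by nlinarith [hy.2]⟩
    linarith
  have hR : 0 ≤ Real.Gamma (1 - ν) * (y * ∑' m : ℕ, y ^ m / Real.Gamma (ν * m + 1)) :=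
    mul_nonneg (Real.Gamma_pos_of_pos (by linarith)).le (mul_nonneg_of_nonpos_of_nonpos hy.2 hle)
  have := mul_nonpos_of_nonneg_of_nonpos hν0.le hI
  linarith
end

section
/- Proposition 4.3: Let η : ℝ → ℂ be continuous with η(0) = 0, and define the Jørgensen set Λ = {λ ∈ (0,∞) : there exists a Borel probability measure μ on ℝ such that ∫ e^{iθx} dμ(x) = exp(λ η(θ)) for all θ ∈ ℝ}. Suppose 1 ∈ Λ. Then Λ is an additive semigroup containing 1 (λ₁, λ₂ ∈ Λ implies λ₁ + λ₂ ∈ Λ) and Λ is closed as a subset of (0,∞) (every λ ∈ (0,∞) that is a limit of points of Λ belongs to Λ). -/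
open MeasureTheory

/-- Proposition 4.3: the Jørgensen set
`Λ = {λ > 0 : exp (λ η(·)) is a characteristic function}` of a continuous
`η` with `η 0 = 0` and `1 ∈ Λ` is an additive semigroup containing 1 which is
closed in `(0,∞)`. -/
theorem jorgensen_set_semigroup_closed
    (η : ℝ → ℂ) (hcont : Continuous η) (h0 : η 0 = 0)
    (Λ : Set ℝ)
    (hΛ : Λ = {l : ℝ | 0 < l ∧ ∃ μ : Measure ℝ, IsProbabilityMeasure μ ∧
      ∀ θ : ℝ, (∫ x : ℝ, Complex.exp (Complex.I * (θ : ℂ) * (x : ℂ)) ∂μ) =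
        Complex.exp ((l : ℂ) * η θ)})
    (h1 : (1 : ℝ) ∈ Λ) :
    (∀ a ∈ Λ, ∀ b ∈ Λ, a + b ∈ Λ) ∧
    (∀ l : ℝ, 0 < l → l ∈ closure Λ → l ∈ Λ) := by
  have key : ∀ (μ : Measure ℝ) (θ : ℝ),
      (∫ x : ℝ, Complex.exp (Complex.I * (θ : ℂ) * (x : ℂ)) ∂μ) = charFun μ θ := by
    intro μ θ
    rw [charFun_apply_real]
    congr 1
    ext x
    congr 1
    ring
  simp only [key] at hΛ
  subst hΛ
  constructor
  · rintro a ⟨ha, μ, hμ, hμa⟩ b ⟨hb, ν, hν, hνb⟩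
    refine ⟨add_pos ha hb, μ.conv ν, inferInstance, fun θ => ?_⟩
    rw [charFun_conv, hμa, hνb, ← Complex.exp_add]
    push_cast
    ring_nf
  · intro l hl hcl
    obtain ⟨u, hu, hul⟩ := mem_closure_iff_seq_limit.1 hcl
    choose hpos μ hμ hμu using hu
    let P : ℕ → ProbabilityMeasure ℝ := fun n => ⟨μ n, hμ n⟩
    have hlim : ∀ t : ℝ, Filter.Tendsto (fun n => charFun (μ n) t) Filter.atTop
        (nhds (Complex.exp ((l : ℂ) * η t))) := by
      intro t
      simp only [hμu]
      have h2 : Filter.Tendsto (fun n => ((u n : ℝ) : ℂ)) Filter.atTop (nhds (l : ℂ)) :=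
        (Complex.continuous_ofReal.tendsto l).comp hul
      exact (Complex.continuous_exp.tendsto _).comp (h2.mul_const (η t))
    have htight : IsTightMeasureSet (Set.range μ) :=
      isTightMeasureSet_of_tendsto_charFun (f := fun t => Complex.exp ((l : ℂ) * η t))
        (by fun_prop) hlim
    have hS : {((ν : ProbabilityMeasure ℝ) : Measure ℝ) | ν ∈ Set.range P} = Set.range μ := by
      ext m
      constructor
      · rintro ⟨_, ⟨n, rfl⟩, rfl⟩
        exact ⟨n, rfl⟩
      · rintro ⟨n, rfl⟩
        exact ⟨P n, ⟨n, rfl⟩, rfl⟩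
    have hc : IsCompact (closure (Set.range P)) :=
      isCompact_closure_of_isTightMeasureSet (by rw [hS]; exact htight)
    obtain ⟨ν, -, φ, hφ, hν⟩ := hc.tendsto_subseq (x := P)
      (fun n => subset_closure (Set.mem_range_self n))
    refine ⟨hl, ν, inferInstance, fun θ => ?_⟩
    have h3 := ProbabilityMeasure.tendsto_iff_tendsto_charFun.1 hν θ
    exact tendsto_nhds_unique h3 ((hlim θ).comp hφ.tendsto_atTop)
end
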